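/- arXiv:2011.06707 — 2 statements merged into one kernel-verified Lean document; each statement's English description precedes it below -/
import Mathlib

section
/- Let V be a finite type (the buses of a DC network) and let E be a finite set of edges, where each edge e has two distinct endpoints i(e), j(e) ∈ V. Given edge admittances y : E → ℂ and shunt admittances d : V → ℂ, define the network admittance matrix Y ∈ ℂ^{V×V} by Y = Σ_{e ∈ E} M_e + diag(d), where M_e has entries (M_e)_{i(e),i(e)} = (M_e)_{j(e),j(e)} = y_e, (M_e)_{i(e),j(e)} = (M_e)_{j(e),i(e)} = −y_e, and zeros elsewhere. If there exists φ ∈ ℝ such that Re(e^{iφ} y_e) > 0 for every edge e and Re(e^{iφ} d_v) > 0 for every vertex v, then Y is invertible. -/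
open Matrix ComplexOrder

namespace Matrix

variable {V : Type*} [Fintype V]

/-- A complex matrix whose quadratic form has, after multiplication by a fixed scalar, positive real
part on nonzero vectors is invertible. -/
theorem isUnit_of_re_mul_dotProduct_mulVec_pos [DecidableEq V] {A : Matrix V V ℂ} (c : ℂ)
    (h : ∀ x ≠ 0, 0 < (c * (star x ⬝ᵥ A *ᵥ x)).re) : IsUnit A := by
  rw [← mulVec_injective_iff_isUnit, ← coe_mulVecLin, injective_iff_map_eq_zero]
  intro x hx
  by_contra hne
  have := h x hne
  rw [mulVecLin_apply] at hx
  simp [hx] at this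

theorem star_dotProduct_vecMulVec_mulVec_of_isSelfAdjoint {w : V → ℂ} (hw : star w = w)
    (x : V → ℂ) : star x ⬝ᵥ vecMulVec w w *ᵥ x = (Complex.normSq (w ⬝ᵥ x) : ℂ) := by
  have h : star x ⬝ᵥ w = star (w ⬝ᵥ x) := by rw [← star_dotProduct_star, hw]
  rw [vecMulVec_mulVec, dotProduct_smul, h, Complex.normSq_eq_conj_mul_self, op_smul_eq_mul,
    starRingEnd_apply]

theorem star_dotProduct_diagonal_mulVec [DecidableEq V] (d x : V → ℂ) :
    star x ⬝ᵥ diagonal d *ᵥ x = ∑ v, d v * (Complex.normSq (x v) : ℂ) := by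
  refine Finset.sum_congr rfl fun v _ => ?_
  rw [mulVec_diagonal, Complex.normSq_eq_conj_mul_self, Pi.star_apply, starRingEnd_apply]
  ring

end Matrix

/-- Decentralized stability certificate (fixed-frequency algebraic content of
Theorem 1): if there is a common rotation `e^{iφ}` making the real parts of all
edge admittances `y e` and all shunt admittances `d v` strictly positive, then
the network admittance matrix `Y = Σ_e M_e + diag d` is invertible, where
`M_e = y e • (δ_{i e} - δ_{j e})(δ_{i e} - δ_{j e})ᵀ`. -/
theorem isUnit_network_admittance_of_rotated_posRe
    {V E : Type*} [Fintype V] [Fintype E] [DecidableEq V]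
    (i j : E → V) (hij : ∀ e, i e ≠ j e)
    (y : E → ℂ) (d : V → ℂ)
    (Y : Matrix V V ℂ)
    (hY : Y = (∑ e : E, y e •
        Matrix.vecMulVec (Pi.single (i e) 1 - Pi.single (j e) 1)
          (Pi.single (i e) 1 - Pi.single (j e) 1)) + Matrix.diagonal d)
    (hφ : ∃ φ : ℝ, (∀ e, 0 < (Complex.exp (φ * Complex.I) * y e).re) ∧
        (∀ v, 0 < (Complex.exp (φ * Complex.I) * d v).re)) :
    IsUnit Y := by
  obtain ⟨φ, hy, hd⟩ := hφ
  subst hY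
  refine isUnit_of_re_mul_dotProduct_mulVec_pos (Complex.exp (φ * Complex.I)) fun x hx => ?_
  obtain ⟨v, hv⟩ := Function.ne_iff.mp hx
  have hw (e : E) : star (Pi.single (i e) 1 - Pi.single (j e) 1 : V → ℂ) =
      Pi.single (i e) 1 - Pi.single (j e) 1 := by
    simp
  simp only [add_mulVec, sum_mulVec, smul_mulVec, dotProduct_add, dotProduct_sum, dotProduct_smul,
    star_dotProduct_vecMulVec_mulVec_of_isSelfAdjoint (hw _), star_dotProduct_diagonal_mulVec,
    smul_eq_mul, mul_add, Finset.mul_sum, ← mul_assoc, Complex.add_re, Complex.re_sum,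
    Complex.re_mul_ofReal]
  refine add_pos_of_nonneg_of_pos
    (Finset.sum_nonneg fun e _ => mul_nonneg (hy e).le (Complex.normSq_nonneg _))
    (Finset.sum_pos' (fun u _ => mul_nonneg (hd u).le (Complex.normSq_nonneg _))
      ⟨v, Finset.mem_univ v, mul_pos (hd v) (Complex.normSq_pos.mpr hv)⟩)
end

section
/- Let V be a finite type and let E be a finite set of edges, where each edge e has two distinct endpoints i(e), j(e) ∈ V. Given nonzero edge admittances y : E → ℂ and nonzero shunt admittances d : V → ℂ, define the network admittance matrix Y = Σ_{e ∈ E} M_e + diag(d) as above. If there exists φ ∈ ℝ such that −π/2 < φ + arg(y_e) < π/2 for every edge e and −π/2 < φ + arg(d_v) < π/2 for every vertex v (with arg the principal argument), then Re(e^{iφ} y_e) > 0 for every e, Re(e^{iφ} d_v) > 0 for every v, and consequently Y is invertible. -/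
open Matrix ComplexOrder

/-- A nonzero complex number whose argument, shifted by `φ`, lies in the open right half-plane
sector has positive real part after rotation by `φ`. -/
lemma re_exp_mul_pos_of_arg_mem_sector {z : ℂ} (hz : z ≠ 0) {φ : ℝ}
    (h : -(Real.pi / 2) < φ + Complex.arg z ∧ φ + Complex.arg z < Real.pi / 2) :
    0 < (Complex.exp (φ * Complex.I) * z).re := by
  have key : Complex.exp (φ * Complex.I) * z =
      (‖z‖ : ℂ) * Complex.exp ((φ + Complex.arg z : ℝ) * Complex.I) := by
    conv_lhs => rw [← Complex.norm_mul_exp_arg_mul_I z]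
    push_cast
    rw [add_mul, Complex.exp_add]
    ring
  rw [key, Complex.re_ofReal_mul, Complex.exp_ofReal_mul_I_re]
  exact mul_pos (norm_pos_iff.mpr hz) (Real.cos_pos_of_mem_Ioo h)

/-- The Hermitian form of a network admittance matrix. -/
lemma star_dotProduct_network_admittance_mulVec
    {V E : Type*} [Fintype V] [Fintype E] [DecidableEq V]
    (i j : E → V) (y : E → ℂ) (d x : V → ℂ) :
    star x ⬝ᵥ (((∑ e : E, y e •
        Matrix.vecMulVec (Pi.single (i e) 1 - Pi.single (j e) 1)
          (Pi.single (i e) 1 - Pi.single (j e) 1)) + Matrix.diagonal d) *ᵥ x) =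
      ∑ e, y e * (Complex.normSq (x (i e) - x (j e)) : ℂ) +
        ∑ v, d v * (Complex.normSq (x v) : ℂ) := by
  rw [Matrix.add_mulVec, dotProduct_add, Matrix.sum_mulVec, dotProduct_sum]
  congr 1
  · refine Finset.sum_congr rfl fun e _ => ?_
    rw [Matrix.smul_mulVec, Matrix.vecMulVec_mulVec, dotProduct_smul, op_smul_eq_smul,
      dotProduct_smul, sub_dotProduct, dotProduct_sub, single_one_dotProduct,
      single_one_dotProduct, dotProduct_single_one, dotProduct_single_one,
      Complex.normSq_eq_conj_mul_self]
    simp only [smul_eq_mul, Pi.star_apply, map_sub, Complex.star_def]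
    ring
  · refine Finset.sum_congr rfl fun v _ => ?_
    rw [Matrix.mulVec_diagonal, Complex.normSq_eq_conj_mul_self]
    simp only [Pi.star_apply, Complex.star_def]
    ring

/-- Fixed-frequency content of Corollary 1: if some common rotation angle `φ`
places the principal arguments of all (nonzero) edge admittances `y e` and
shunt admittances `d v` strictly inside the sector `(-π/2, π/2)`, then all
rotated admittances have strictly positive real part, and consequently the
network admittance matrix `Y = Σ_e M_e + diag d` is invertible. -/
theorem isUnit_network_admittance_of_phase_sector
    {V E : Type*} [Fintype V] [Fintype E] [DecidableEq V]
    (i j : E → V) (hij : ∀ e, i e ≠ j e)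
    (y : E → ℂ) (hy : ∀ e, y e ≠ 0)
    (d : V → ℂ) (hd : ∀ v, d v ≠ 0)
    (Y : Matrix V V ℂ)
    (hY : Y = (∑ e : E, y e •
        Matrix.vecMulVec (Pi.single (i e) 1 - Pi.single (j e) 1)
          (Pi.single (i e) 1 - Pi.single (j e) 1)) + Matrix.diagonal d)
    (φ : ℝ)
    (hyφ : ∀ e, -(Real.pi / 2) < φ + Complex.arg (y e) ∧
        φ + Complex.arg (y e) < Real.pi / 2)
    (hdφ : ∀ v, -(Real.pi / 2) < φ + Complex.arg (d v) ∧
        φ + Complex.arg (d v) < Real.pi / 2) :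
    (∀ e, 0 < (Complex.exp (φ * Complex.I) * y e).re) ∧
    (∀ v, 0 < (Complex.exp (φ * Complex.I) * d v).re) ∧
    IsUnit Y := by
  have hy_pos e := re_exp_mul_pos_of_arg_mem_sector (hy e) (hyφ e)
  have hd_pos v := re_exp_mul_pos_of_arg_mem_sector (hd v) (hdφ v)
  refine ⟨hy_pos, hd_pos, ?_⟩
  rw [← Matrix.mulVec_injective_iff_isUnit, ← Matrix.coe_mulVecLin,
    injective_iff_map_eq_zero]
  intro x hx
  rw [Matrix.mulVecLin_apply] at hx
  have hform := star_dotProduct_network_admittance_mulVec i j y d x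
  rw [← hY, hx, dotProduct_zero] at hform
  have hre := congrArg (fun z => (Complex.exp (φ * Complex.I) * z).re) hform
  simp only [mul_zero, mul_add, Finset.mul_sum, ← mul_assoc, Complex.add_re, Complex.re_sum,
    Complex.re_mul_ofReal, Complex.zero_re] at hre
  have hE : 0 ≤ ∑ e, (Complex.exp (φ * Complex.I) * y e).re *
      Complex.normSq (x (i e) - x (j e)) :=
    Finset.sum_nonneg fun e _ => mul_nonneg (hy_pos e).le (Complex.normSq_nonneg _)
  have hterm : ∀ v ∈ Finset.univ,
      0 ≤ (Complex.exp (φ * Complex.I) * d v).re * Complex.normSq (x v) :=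
    fun v _ => mul_nonneg (hd_pos v).le (Complex.normSq_nonneg _)
  have hV : ∑ v, (Complex.exp (φ * Complex.I) * d v).re * Complex.normSq (x v) = 0 :=
    le_antisymm (by linarith) (Finset.sum_nonneg hterm)
  funext v
  have hv := (Finset.sum_eq_zero_iff_of_nonneg hterm).mp hV v (Finset.mem_univ v)
  exact Complex.normSq_eq_zero.mp ((mul_eq_zero.mp hv).resolve_left (hd_pos v).ne')
end
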